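/- Let m ≥ 2 and let (z₁, …, z_m) and (w₁, …, w_m) be m-tuples of nonzero vectors in ℍ^{n+1} with ⟨z_k,z_k⟩ ≤ 0 and ⟨w_k,w_k⟩ ≤ 0 for all k, and with z_k ∉ z_l·ℍ and w_k ∉ w_l·ℍ for all k ≠ l. Then the two tuples are PSp(n,1)-congruent if and only if their Gram matrices are equivalent, i.e. if and only if there exists an invertible diagonal quaternionic matrix D with G_z = D* G_w D, where G_z and G_w are the Gram matrices of the two tuples. -/

import Mathlib

noncomputable section

open Quaternion Matrix
open scoped Classical

abbrev ℍq : Type := Quaternion ℝ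

/-- Hermitian form matrix of signature (n,1). -/
def qHmat (n : ℕ) : Matrix (Fin (n+1)) (Fin (n+1)) ℍq := fun k j =>
  if (k = 0 ∧ j = Fin.last n) ∨ (k = Fin.last n ∧ j = 0) then 1
  else if k = j ∧ k ≠ 0 ∧ k ≠ Fin.last n then 1 else 0

/-- `herm n z w = ⟨z,w⟩ = w* H z`. -/
def herm (n : ℕ) (z w : Fin (n+1) → ℍq) : ℍq :=
  ∑ k, ∑ j, star (w k) * qHmat n k j * z j

/-- Two `m`-tuples of vectors are PSp(n,1)-congruent if some `C ∈ Sp(n,1)` carries each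
`p k` to `q k` up to a nonzero right quaternionic scalar. -/
def PSpCongruent (n m : ℕ) (p q : Fin m → Fin (n+1) → ℍq) : Prop :=
  ∃ C : Matrix (Fin (n+1)) (Fin (n+1)) ℍq, Cᴴ * qHmat n * C = qHmat n ∧
    ∃ μ : Fin m → ℍq, (∀ k, μ k ≠ 0) ∧ ∀ k, C.mulVec (p k) = fun j => q k j * μ k

/-- An `m`-tuple `p` (first `i` entries null, the rest negative, pairwise projectively
distinct) is semi-normalized if its Gram matrix `g_{kj} = ⟨p_j, p_k⟩` satisfies
`g_{kk} = 0` for `1 ≤ k ≤ i`, `|g_{23}| = 1`, `g_{1j} = 1` for `2 ≤ j ≤ i`,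
`g_{kk} = −1` for `i+1 ≤ k ≤ m`, and `g_{1j}` positive real for `i+1 ≤ j ≤ m`
(1-based indexing). -/
def SemiNormalized (n m i : ℕ) (p : Fin m → Fin (n+1) → ℍq) : Prop :=
  (∀ k, p k ≠ 0) ∧
  (∀ k l : Fin m, k ≠ l → ∀ c : ℍq, p k ≠ fun j => p l j * c) ∧
  (∀ k : Fin m, (k : ℕ) < i → herm n (p k) (p k) = 0) ∧
  (∀ k j : Fin m, (k : ℕ) = 1 → (j : ℕ) = 2 → ‖herm n (p j) (p k)‖ = 1) ∧
  (∀ k j : Fin m, (k : ℕ) = 0 → 1 ≤ (j : ℕ) → (j : ℕ) < i → herm n (p j) (p k) = 1) ∧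
  (∀ k : Fin m, i ≤ (k : ℕ) → herm n (p k) (p k) = -1) ∧
  (∀ k j : Fin m, (k : ℕ) = 0 → i ≤ (j : ℕ) → ∃ r : ℝ, 0 < r ∧ herm n (p j) (p k) = (r : ℍq))

/-- The Korányi–Reimann quaternionic cross ratio. -/
def crossRatio (n : ℕ) (z1 z2 z3 z4 : Fin (n+1) → ℍq) : ℍq :=
  herm n z3 z1 * (herm n z3 z2)⁻¹ * herm n z4 z2 * (herm n z4 z1)⁻¹

/-- The quaternionic Cartan angular invariant
`𝔸(z₁,z₂,z₃) = arccos(Re(−T)/|T|)` with `T = ⟨z₁,z₂⟩⟨z₂,z₃⟩⟨z₃,z₁⟩`. -/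
def angInv (n : ℕ) (z1 z2 z3 : Fin (n+1) → ℍq) : ℝ :=
  Real.arccos ((-(herm n z1 z2 * herm n z2 z3 * herm n z3 z1)).re /
    ‖herm n z1 z2 * herm n z2 z3 * herm n z3 z1‖)

/-- The rotation invariant `u(g) = Im g / |Im g|` (and `0` if `Im g = 0`). -/
def rotInv (g : ℍq) : ℍq := if g.im = 0 then 0 else (‖g.im‖)⁻¹ • g.im

/-- The distance invariant `d(z,w) = (⟨w,z⟩·⟨z,w⟩)/(⟨w,w⟩·⟨z,z⟩)`. -/
def dInv (n : ℕ) (z w : Fin (n+1) → ℍq) : ℍq :=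
  (herm n w z * herm n z w) / (herm n w w * herm n z z)

lemma qHmat_eq_ite (n : ℕ) (k j : Fin (n+1)) :
    qHmat n k j = if j = Equiv.swap 0 (Fin.last n) k then 1 else 0 := by
  unfold qHmat
  rcases eq_or_ne k 0 with rfl | h0
  · rcases eq_or_ne (0 : Fin (n+1)) (Fin.last n) with h | h
    · simp [← h]
    · simp [h]
  · rcases eq_or_ne k (Fin.last n) with rfl | hl
    · simp [h0]
    · simp [h0, hl, Equiv.swap_apply_of_ne_of_ne h0 hl, eq_comm]

lemma herm_eq_sum_swap (n : ℕ) (x y : Fin (n+1) → ℍq) :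
    herm n x y = ∑ k, star (y k) * x (Equiv.swap 0 (Fin.last n) k) := by
  simp [herm, qHmat_eq_ite]

lemma herm_eq_dotProduct (n : ℕ) (x y : Fin (n+1) → ℍq) :
    herm n x y = star y ⬝ᵥ (qHmat n *ᵥ x) := by
  simp [herm, dotProduct, mulVec, Finset.mul_sum, mul_assoc]

lemma herm_sub_left (n : ℕ) (x x' y : Fin (n+1) → ℍq) :
    herm n (x - x') y = herm n x y - herm n x' y := by
  simp [herm_eq_sum_swap, mul_sub, Finset.sum_sub_distrib]

lemma herm_sub_right (n : ℕ) (x y y' : Fin (n+1) → ℍq) :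
    herm n x (y - y') = herm n x y - herm n x y' := by
  simp [herm_eq_sum_swap, sub_mul, Finset.sum_sub_distrib]

lemma herm_mul_left (n : ℕ) (x y : Fin (n+1) → ℍq) (c : ℍq) :
    herm n (fun j => x j * c) y = herm n x y * c := by
  simp [herm_eq_sum_swap, Finset.sum_mul, mul_assoc]

lemma herm_mul_right (n : ℕ) (x y : Fin (n+1) → ℍq) (c : ℍq) :
    herm n x (fun j => y j * c) = star c * herm n x y := by
  simp [herm_eq_sum_swap, Finset.mul_sum, mul_assoc]

lemma star_herm (n : ℕ) (x y : Fin (n+1) → ℍq) : star (herm n x y) = herm n y x := by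
  rw [herm_eq_sum_swap, herm_eq_sum_swap, star_sum]
  refine Fintype.sum_equiv (Equiv.swap 0 (Fin.last n)) _ _ fun k => ?_
  simp

lemma herm_single_right (n : ℕ) (x : Fin (n+1) → ℍq) (b : Fin (n+1)) :
    herm n x (Pi.single b 1) = x (Equiv.swap 0 (Fin.last n) b) := by
  rw [herm_eq_sum_swap, Finset.sum_eq_single b]
  · simp
  · intro k _ hk
    simp [Pi.single_eq_of_ne hk]
  · simp

lemma herm_mulVec {n : ℕ} {C : Matrix (Fin (n+1)) (Fin (n+1)) ℍq}
    (hC : Cᴴ * qHmat n * C = qHmat n) (x y : Fin (n+1) → ℍq) :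
    herm n (C *ᵥ x) (C *ᵥ y) = herm n x y := by
  rw [herm_eq_dotProduct, herm_eq_dotProduct, star_mulVec, ← dotProduct_mulVec,
    mulVec_mulVec, mulVec_mulVec, hC]

lemma conjTranspose_mul_qHmat_mul_of_herm {n : ℕ} {C : Matrix (Fin (n+1)) (Fin (n+1)) ℍq}
    (hC : ∀ x y, herm n (C *ᵥ x) (C *ᵥ y) = herm n x y) : Cᴴ * qHmat n * C = qHmat n := by
  have key : ∀ x y : Fin (n+1) → ℍq,
      star y ⬝ᵥ ((Cᴴ * qHmat n * C) *ᵥ x) = star y ⬝ᵥ (qHmat n *ᵥ x) := by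
    intro x y
    rw [← herm_eq_dotProduct, ← hC, herm_eq_dotProduct, star_mulVec, ← dotProduct_mulVec,
      mulVec_mulVec, mulVec_mulVec]
  ext1 i j
  have := key (Pi.single j 1) (Pi.single i 1)
  rw [← Pi.single_star] at this
  simpa using this

lemma conjTranspose_mul_qHmat_mul_mul {n : ℕ} {B C : Matrix (Fin (n+1)) (Fin (n+1)) ℍq}
    (hB : Bᴴ * qHmat n * B = qHmat n) (hC : Cᴴ * qHmat n * C = qHmat n) :
    (B * C)ᴴ * qHmat n * (B * C) = qHmat n :=
  conjTranspose_mul_qHmat_mul_of_herm fun x y => by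
    rw [← mulVec_mulVec, ← mulVec_mulVec, herm_mulVec hB, herm_mulVec hC]

/-- A quasi-reflection along `u - v` carries `u` to a vector `v` of the same norm and fixes the
orthogonal complement of `u - v`. -/
lemma exists_quasiReflection {n : ℕ} {u v : Fin (n+1) → ℍq}
    (huv : herm n u u = herm n v v) (h : herm n u (u - v) ≠ 0) :
    ∃ C : Matrix (Fin (n+1)) (Fin (n+1)) ℍq, Cᴴ * qHmat n * C = qHmat n ∧ C *ᵥ u = v ∧
      ∀ x, herm n x (u - v) = 0 → C *ᵥ x = x := by
  set d := u - v with hd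
  set g := herm n u d with hg
  let C : Matrix (Fin (n+1)) (Fin (n+1)) ℍq :=
    1 - vecMulVec (fun i => d i * g⁻¹) (star d ᵥ* qHmat n)
  have hCx : ∀ x, C *ᵥ x = x - fun i => d i * (g⁻¹ * herm n x d) := by
    intro x
    ext1 i
    rw [herm_eq_dotProduct, dotProduct_mulVec]
    simp only [C, sub_mulVec, one_mulVec, Pi.sub_apply]
    simp only [mulVec, vecMulVec_apply, dotProduct, Finset.mul_sum, mul_assoc]
  refine ⟨C, conjTranspose_mul_qHmat_mul_of_herm fun x y => ?_, ?_, fun x hx => ?_⟩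
  · have hdd : herm n d d = g + star g := by
      rw [hg, star_herm, hd]
      simp only [herm_sub_left, herm_sub_right, huv]
      abel
    have hs : star g ≠ 0 := star_ne_zero.mpr h
    have hquad : star g⁻¹ * herm n d d * g⁻¹ = g⁻¹ + star g⁻¹ := by
      rw [hdd, star_inv₀, mul_add, add_mul, mul_assoc, mul_inv_cancel₀ h, inv_mul_cancel₀ hs]
      rw [mul_one, one_mul, add_comm]
    rw [hCx, hCx]
    simp only [herm_sub_left, herm_sub_right, herm_mul_left, herm_mul_right, star_mul, star_herm]
    have : herm n d y * star g⁻¹ * (herm n d d * (g⁻¹ * herm n x d))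
        = herm n d y * (g⁻¹ + star g⁻¹) * herm n x d := by
      rw [← hquad]
      simp only [mul_assoc]
    rw [mul_sub, this]
    noncomm_ring
  · rw [hCx, ← hg, inv_mul_cancel₀ h]
    ext1 i
    simp [hd]
  · rw [hCx, hx]
    ext1 i
    simp

lemma eq_zero_of_herm_self_nonpos {n : ℕ} {y : Fin (n+1) → ℍq} {b : Fin (n+1)}
    (hb : b = 0 ∨ b = Fin.last n) (hyb : y b = 0) (hy : (herm n y y).re ≤ 0)
    {k : Fin (n+1)} (hk : k ≠ Equiv.swap 0 (Fin.last n) b) : y k = 0 := by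
  set σ := Equiv.swap 0 (Fin.last n) with hσ
  have hterm : ∀ k, (star (y k) * y (σ k)).re = if k = b ∨ k = σ b then 0 else ‖y k‖ ^ 2 := by
    intro k
    split_ifs with h
    · rcases h with rfl | rfl
      · simp [hyb]
      · simp [hσ, hyb]
    · have hk' : σ k = k := by
        refine Equiv.swap_apply_of_ne_of_ne ?_ ?_ <;> rintro rfl <;>
          rcases hb with rfl | rfl <;> simp [hσ] at h
      rw [hk', Quaternion.star_mul_self, Quaternion.re_coe, Quaternion.normSq_eq_norm_mul_self, sq]
  have hsum : ∑ k, (star (y k) * y (σ k)).re ≤ 0 := by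
    rw [herm_eq_sum_swap] at hy
    have : ∀ s : Finset (Fin (n+1)), (∑ k ∈ s, star (y k) * y (σ k)).re
        = ∑ k ∈ s, (star (y k) * y (σ k)).re := by
      intro s
      induction s using Finset.induction_on with
      | empty => simp
      | insert a s ha ih => rw [Finset.sum_insert ha, Finset.sum_insert ha, Quaternion.re_add, ih]
    rwa [this] at hy
  have hnn : ∀ k ∈ Finset.univ, 0 ≤ (star (y k) * y (σ k)).re := by
    intro k _
    rw [hterm]
    positivity
  have h0 := (Finset.sum_eq_zero_iff_of_nonneg hnn).1
    (le_antisymm hsum (Finset.sum_nonneg hnn)) k (Finset.mem_univ k)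
  by_cases hkb : k = b
  · rw [hkb, hyb]
  · rw [hterm, if_neg (by tauto)] at h0
    simpa using h0

lemma exists_coord_ne_zero_of_null {n : ℕ} {d : Fin (n+1) → ℍq} (hd : d ≠ 0)
    (hdd : herm n d d = 0) : ∃ b, (b = 0 ∨ b = Fin.last n) ∧ d b ≠ 0 := by
  by_contra! h
  refine hd (funext fun k => ?_)
  by_cases hk : k = Fin.last n
  · rw [hk]
    exact h _ (Or.inr rfl)
  · exact eq_zero_of_herm_self_nonpos (Or.inl rfl) (h 0 (Or.inl rfl)) (by simp [hdd])
      (by simpa using hk)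

/-- A nonpositive vector orthogonal to a nonzero null vector is proportional to it. -/
lemma exists_eq_mul_of_orthogonal_null {n : ℕ} {d x : Fin (n+1) → ℍq} (hd : d ≠ 0)
    (hdd : herm n d d = 0) (hx : (herm n x x).re ≤ 0) (hxd : herm n x d = 0) :
    ∃ c : ℍq, x = fun j => d j * c := by
  obtain ⟨b, hb, hdb⟩ := exists_coord_ne_zero_of_null hd hdd
  refine ⟨(d b)⁻¹ * x b, ?_⟩
  set c := (d b)⁻¹ * x b with hc
  set y := x - fun j => d j * c with hy
  have hdx : herm n d x = 0 := by rw [← star_herm, hxd, star_zero]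
  have hyb : y b = 0 := by simp [hy, hc, mul_inv_cancel_left₀ hdb]
  have hyy : herm n y y = herm n x x := by
    simp [hy, herm_sub_left, herm_sub_right, herm_mul_left, herm_mul_right, hxd, hdx, hdd]
  have hyd : herm n y d = 0 := by simp [hy, herm_sub_left, herm_mul_left, hxd, hdd]
  have hy0 : ∀ k, k ≠ Equiv.swap 0 (Fin.last n) b → y k = 0 := fun k hk =>
    eq_zero_of_herm_self_nonpos hb hyb (by rwa [hyy]) hk
  have hys : y (Equiv.swap 0 (Fin.last n) b) = 0 := by
    rw [herm_eq_sum_swap, Finset.sum_eq_single b] at hyd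
    · simpa [hdb] using hyd
    · intro k _ hk
      rw [hy0 _ (by simpa using hk), mul_zero]
    · simp
  refine sub_eq_zero.1 (funext fun k => ?_)
  by_cases hk : k = Equiv.swap 0 (Fin.last n) b
  · rw [hk]
    exact hys
  · exact hy0 k hk

/-- If `u` and `v` have the same norm and `u` is orthogonal to `u - v`, then `u - v` is null. -/
lemma herm_sub_self_eq_zero {n : ℕ} {u v : Fin (n+1) → ℍq}
    (huv : herm n u u = herm n v v) (h : herm n u (u - v) = 0) :
    herm n (u - v) (u - v) = 0 := by
  have h' : herm n (u - v) u = 0 := by rw [← star_herm, h, star_zero]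
  rw [herm_sub_right] at h
  rw [herm_sub_left] at h'
  rw [herm_sub_left, herm_sub_right, herm_sub_right, h, ← huv, zero_sub, neg_eq_zero, ← neg_sub, h',
    neg_zero]

/-- `Sp(n,1)` acts transitively on nonzero nonpositive vectors of a given norm. -/
lemma exists_mulVec_eq {n : ℕ} (hn : n ≠ 0) {u v : Fin (n+1) → ℍq} (hu : u ≠ 0) (hv : v ≠ 0)
    (huv : herm n u u = herm n v v) (hneg : (herm n u u).re ≤ 0) :
    ∃ C : Matrix (Fin (n+1)) (Fin (n+1)) ℍq, Cᴴ * qHmat n * C = qHmat n ∧ C *ᵥ u = v := by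
  by_cases h : herm n u (u - v) = 0
  · by_cases hd : u - v = 0
    · exact ⟨1, by simp, by rw [one_mulVec, sub_eq_zero.1 hd]⟩
    have hdd := herm_sub_self_eq_zero huv h
    obtain ⟨c, hc⟩ := exists_eq_mul_of_orthogonal_null hd hdd hneg h
    have hvd : herm n v (u - v) = 0 := by
      have := hdd
      rwa [herm_sub_left, h, zero_sub, neg_eq_zero] at this
    obtain ⟨c', hc'⟩ := exists_eq_mul_of_orthogonal_null hd hdd (huv ▸ hneg) hvd
    obtain ⟨b, hb, hdb⟩ := exists_coord_ne_zero_of_null hd hdd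
    generalize u - v = d at *
    have hc0 : c ≠ 0 := by
      rintro rfl
      exact hu (hc.trans (by ext1; simp))
    have hc0' : c' ≠ 0 := by
      rintro rfl
      exact hv (hc'.trans (by ext1; simp))
    set e : Fin (n+1) → ℍq := Pi.single (Equiv.swap 0 (Fin.last n) b) 1 with he
    have hl : Fin.last n ≠ 0 := by simpa [Fin.ext_iff] using hn
    have hee : herm n e e = 0 := by
      rw [he, herm_single_right]
      rcases hb with rfl | rfl <;> simp [hl, hl.symm]
    have hde : herm n d e = d b := by rw [he, herm_single_right]; simp
    have huu : herm n u u = 0 := by rw [hc, herm_mul_left, herm_mul_right, hdd]; simp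
    have hue : herm n u e ≠ 0 := by
      rw [hc, herm_mul_left, hde]
      exact mul_ne_zero hdb hc0
    have hev : herm n e v ≠ 0 := by
      rw [← star_herm, hc', herm_mul_left, hde]
      exact star_ne_zero.mpr (mul_ne_zero hdb hc0')
    obtain ⟨A, hA, hAu, -⟩ := exists_quasiReflection (u := u) (v := e) (by rw [huu, hee])
      (by rwa [herm_sub_right, huu, zero_sub, neg_ne_zero])
    obtain ⟨B, hB, hBe, -⟩ := exists_quasiReflection (u := e) (v := v) (by rw [← huv, huu, hee])
      (by rwa [herm_sub_right, hee, zero_sub, neg_ne_zero])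
    exact ⟨B * A, conjTranspose_mul_qHmat_mul_mul hB hA, by rw [← mulVec_mulVec, hAu, hBe]⟩
  · obtain ⟨C, hC, hCu, -⟩ := exists_quasiReflection huv h
    exact ⟨C, hC, hCu⟩

/-- Tuples of nonzero, nonpositive, pairwise non-proportional vectors with equal Gram matrices
are related by an element of `Sp(n,1)`. -/
lemma exists_mulVec_eq_of_herm_eq {n m : ℕ} (hn : n ≠ 0) {z w : Fin m → Fin (n+1) → ℍq}
    (hz0 : ∀ k, z k ≠ 0) (hw0 : ∀ k, w k ≠ 0)
    (hw : ∀ k, (herm n (w k) (w k)).re ≤ 0)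
    (hwd : ∀ k l : Fin m, k ≠ l → ∀ c : ℍq, w k ≠ fun j => w l j * c)
    (hG : ∀ k j, herm n (z j) (z k) = herm n (w j) (w k)) :
    ∃ C : Matrix (Fin (n+1)) (Fin (n+1)) ℍq, Cᴴ * qHmat n * C = qHmat n ∧
      ∀ k, C *ᵥ z k = w k := by
  suffices H : ∀ k : ℕ, k ≤ m → ∃ C : Matrix (Fin (n+1)) (Fin (n+1)) ℍq,
      Cᴴ * qHmat n * C = qHmat n ∧ ∀ i : Fin m, (i : ℕ) < k → C *ᵥ z i = w i by
    obtain ⟨C, hC, h⟩ := H m le_rfl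
    exact ⟨C, hC, fun k => h k k.2⟩
  intro k
  induction k with
  | zero => exact fun _ => ⟨1, by simp, fun i hi => absurd hi (Nat.not_lt_zero _)⟩
  | succ k ih =>
    intro hk
    rcases Nat.eq_zero_or_pos k with rfl | hpos
    · obtain ⟨C, hC, h⟩ := exists_mulVec_eq hn (hz0 ⟨0, hk⟩) (hw0 ⟨0, hk⟩) (hG _ _)
        (by rw [hG]; exact hw _)
      refine ⟨C, hC, fun i hi => ?_⟩
      obtain rfl : i = ⟨0, hk⟩ := Fin.ext (by simpa using hi)
      exact h
    · obtain ⟨C, hC, h⟩ := ih (by omega)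
      set a : Fin m := ⟨k, hk⟩ with ha
      set o : Fin m := ⟨0, by omega⟩ with ho
      have huv : herm n (C *ᵥ z a) (C *ᵥ z a) = herm n (w a) (w a) := by rw [herm_mulVec hC, hG]
      have horth : ∀ i : Fin m, (i : ℕ) < k → herm n (w i) (C *ᵥ z a - w a) = 0 := by
        intro i hi
        rw [herm_sub_right, ← hG a i, ← herm_mulVec hC (z i) (z a), h i hi, sub_self]
      by_cases hu : herm n (C *ᵥ z a) (C *ᵥ z a - w a) = 0
      · have hd : C *ᵥ z a - w a = 0 := by
          by_contra hd
          have hdd := herm_sub_self_eq_zero huv hu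
          have hvd : herm n (w a) (C *ᵥ z a - w a) = 0 := by
            have := hdd
            rwa [herm_sub_left, hu, zero_sub, neg_eq_zero] at this
          obtain ⟨c, hc⟩ := exists_eq_mul_of_orthogonal_null hd hdd (hw a) hvd
          obtain ⟨c', hc'⟩ := exists_eq_mul_of_orthogonal_null hd hdd (hw o) (horth o hpos)
          have hc0 : c ≠ 0 := by
            rintro rfl
            exact hw0 a (hc.trans (by ext1; simp))
          refine hwd o a (by simp [ha, ho, Fin.ext_iff, hpos.ne]) (c⁻¹ * c') (funext fun j => ?_)
          rw [congrFun hc j, congrFun hc' j, mul_assoc, mul_inv_cancel_left₀ hc0]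
        refine ⟨C, hC, fun i hi => ?_⟩
        rcases Nat.lt_succ_iff_lt_or_eq.1 hi with hi | hi
        · exact h i hi
        · obtain rfl : i = a := Fin.ext hi
          exact sub_eq_zero.1 hd
      · obtain ⟨B, hB, hBu, hBfix⟩ := exists_quasiReflection huv hu
        refine ⟨B * C, conjTranspose_mul_qHmat_mul_mul hB hC, fun i hi => ?_⟩
        rw [← mulVec_mulVec]
        rcases Nat.lt_succ_iff_lt_or_eq.1 hi with hi | hi
        · rw [h i hi, hBfix _ (horth i hi)]
        · obtain rfl : i = a := Fin.ext hi
          exact hBu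

/-- **Congruence via Gram matrices.** Two `m`-tuples of pairwise projectively distinct
vectors from the closure of quaternionic hyperbolic space (`⟨z,z⟩ ≤ 0`) are
PSp(n,1)-congruent if and only if their Gram matrices are equivalent, i.e. differ by
`G_z = D* G_w D` for an invertible diagonal quaternionic matrix `D`. -/
theorem congruent_iff_gram_equivalent (n m : ℕ) (hm : 2 ≤ m)
    (z w : Fin m → Fin (n+1) → ℍq)
    (hz0 : ∀ k, z k ≠ 0) (hw0 : ∀ k, w k ≠ 0)
    (hz : ∀ k, ∃ r : ℝ, r ≤ 0 ∧ herm n (z k) (z k) = (r : ℍq))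
    (hw : ∀ k, ∃ r : ℝ, r ≤ 0 ∧ herm n (w k) (w k) = (r : ℍq))
    (hzd : ∀ k l : Fin m, k ≠ l → ∀ c : ℍq, z k ≠ fun j => z l j * c)
    (hwd : ∀ k l : Fin m, k ≠ l → ∀ c : ℍq, w k ≠ fun j => w l j * c) :
    PSpCongruent n m z w ↔
      ∃ D : Fin m → ℍq, (∀ k, D k ≠ 0) ∧
        ∀ k j : Fin m, herm n (z j) (z k) = star (D k) * herm n (w j) (w k) * D j := by
  constructor
  · rintro ⟨C, hC, μ, hμ, h⟩
    refine ⟨μ, hμ, fun k j => ?_⟩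
    rw [← herm_mulVec hC, h, h, herm_mul_left, herm_mul_right]
  · rintro ⟨D, hD, hG⟩
    rcases eq_or_ne n 0 with rfl | hn
    · have h1 : z ⟨1, hm⟩ 0 ≠ 0 := fun h =>
        hz0 ⟨1, hm⟩ (funext fun j => by rw [Fin.fin_one_eq_zero j]; exact h)
      refine absurd (funext fun j => ?_)
        (hzd ⟨0, by omega⟩ ⟨1, hm⟩ (by simp) ((z ⟨1, hm⟩ 0)⁻¹ * z ⟨0, by omega⟩ 0))
      rw [Fin.fin_one_eq_zero j, mul_inv_cancel_left₀ h1]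
    have hcancel : ∀ k, (fun j => (fun i => w k i * D k) j * (D k)⁻¹) = w k := fun k =>
      funext fun j => mul_inv_cancel_right₀ (hD k) _
    have hG' : ∀ k j, herm n (z j) (z k)
        = herm n (fun i => w j i * D j) (fun i => w k i * D k) := fun k j => by
      rw [hG, herm_mul_left, herm_mul_right]
    obtain ⟨C, hC, h⟩ := exists_mulVec_eq_of_herm_eq hn
      (w := fun k i => w k i * D k) hz0
      (fun k hk => hw0 k (by rw [← hcancel k, hk]; ext1; simp))
      (fun k => by
        obtain ⟨r, hr, hzr⟩ := hz k
        rw [← hG', hzr]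
        exact hr)
      (fun k l hkl c hc => hwd k l hkl (D l * c * (D k)⁻¹) (by
        rw [← hcancel k, hc]
        simp only [mul_assoc]))
      hG'
    exact ⟨C, hC, D, hD, h⟩
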